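/- For all nonnegative integers n and k, ĉ_{n,k} = Σ_{m=0}^{n} Σ_{i=0}^{m} C(k−i, m−i) · A(k,i) · c(n+1, m+1), where C(k−i, m−i) denotes the binomial coefficient (equal to 0 when m−i > k−i). -/

import Mathlib

/-- Unsigned Stirling numbers of the first kind:
`c(0,0)=1`, `c(n,m)=0` for `m>n` or (`n>0` and `m=0`), and `c(n+1,m)=n*c(n,m)+c(n,m-1)`. -/
def stirling1 : ℕ → ℕ → ℕ
  | 0, 0 => 1
  | 0, _ + 1 => 0
  | _ + 1, 0 => 0
  | n + 1, m + 1 => n * stirling1 n (m + 1) + stirling1 n m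

/-- Stirling numbers of the second kind:
`S(0,0)=1`, `S(n,m)=0` for `m>n` or (`n>0` and `m=0`), and `S(n+1,m)=m*S(n,m)+S(n,m-1)`. -/
def stirling2 : ℕ → ℕ → ℕ
  | 0, 0 => 1
  | 0, _ + 1 => 0
  | _ + 1, 0 => 0
  | n + 1, m + 1 => (m + 1) * stirling2 n (m + 1) + stirling2 n m

/-- Poly-Cauchy numbers of the second kind (negated upper index, unsigned):
`ĉ_{n,k} = Σ_{m=0}^n c(n,m)·(m+1)^k`. -/
def polyCauchy (n k : ℕ) : ℕ := ∑ m ∈ Finset.range (n + 1), stirling1 n m * (m + 1) ^ k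

/-- Eulerian number `A(k,i)`: the number of permutations of `k` letters with exactly
`i` descents (a descent of `σ` is a position `p` with `σ p > σ (p+1)`); `A(0,0) = 1`. -/
noncomputable def eulerian (k i : ℕ) : ℕ :=
  Nat.card {σ : Equiv.Perm (Fin k) //
    Nat.card {p : Fin k // ∃ h : (p : ℕ) + 1 < k, σ ⟨(p : ℕ) + 1, h⟩ < σ p} = i}

theorem stirling1_eq_zero_of_lt : ∀ {n m : ℕ}, n < m → stirling1 n m = 0
  | 0, _ + 1, _ => by rw [stirling1]
  | n + 1, m + 1, h => by
    rw [stirling1, stirling1_eq_zero_of_lt (by omega : n < m + 1),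
      stirling1_eq_zero_of_lt (by omega : n < m), mul_zero]

theorem mul_stirling1_zero_right (n : ℕ) : n * stirling1 n 0 = 0 := by
  cases n <;> simp [stirling1]

theorem sum_stirling1_succ_mul (n : ℕ) (f : ℕ → ℕ) :
    ∑ m ∈ Finset.range (n + 2), stirling1 (n + 1) m * f m =
      n * ∑ m ∈ Finset.range (n + 1), stirling1 n m * f m +
        ∑ m ∈ Finset.range (n + 1), stirling1 n m * f (m + 1) := by
  have h : n * ∑ m ∈ Finset.range (n + 1), stirling1 n m * f m =
      n * ∑ m ∈ Finset.range (n + 1), stirling1 n (m + 1) * f (m + 1) := by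
    rw [Finset.sum_range_succ', Finset.sum_range_succ _ n, stirling1_eq_zero_of_lt n.lt_succ_self,
      mul_add, ← mul_assoc n, mul_stirling1_zero_right]
    simp
  rw [h, Finset.sum_range_succ', Finset.mul_sum, ← Finset.sum_add_distrib]
  simp only [stirling1, zero_mul, add_zero]
  exact Finset.sum_congr rfl fun _ _ => by ring

theorem stirling1_succ_succ_eq_sum_choose (n j : ℕ) :
    stirling1 (n + 1) (j + 1) =
      ∑ m ∈ Finset.range (n + 1), stirling1 n m * m.choose j := by
  induction n generalizing j with
  | zero => cases j <;> simp [stirling1]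
  | succ n ih =>
    rw [sum_stirling1_succ_mul, ← ih, stirling1]
    cases j with
    | zero =>
      have h := ih 0
      simp only [Nat.choose_zero_right] at h ⊢
      rw [← h, show stirling1 (n + 1) 0 = 0 by rw [stirling1]]
      ring
    | succ j =>
      simp only [Nat.choose_succ_succ', mul_add, Finset.sum_add_distrib, ← ih]
      ring

theorem card_strictMono_fin (k N : ℕ) :
    Nat.card {h : Fin k → Fin N // StrictMono h} = N.choose k := by
  let e : {h : Fin k → Fin N // StrictMono h} ≃ (Fin k ↪o Fin N) :=
    { toFun h := OrderEmbedding.ofStrictMono h.1 h.2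
      invFun f := ⟨f, f.strictMono⟩
      left_inv _ := rfl
      right_inv _ := rfl }
  rw [Nat.card_congr (e.trans Set.powersetCard.ofFinEmbEquiv), Set.powersetCard.card]
  simp

/-- Adding an integer sequence with steps `0` or `1` turns the tuples that increase strictly
at the steps `0` and weakly at the steps `1` into strictly increasing tuples. -/
theorem card_strictMono_add {n : ℕ} (m : ℕ) (e : Fin (n + 1) → ℕ) (h0 : e 0 = 0)
    (hmono : Monotone e) (hstep : ∀ i : Fin n, e i.succ ≤ e i.castSucc + 1) :
    Nat.card {g : Fin (n + 1) → Fin (m + 1) // StrictMono fun i => (g i : ℕ) + e i} =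
      (m + 1 + e (Fin.last n)).choose (n + 1) := by
  have key (h : Fin (n + 1) → Fin (m + 1 + e (Fin.last n))) (hh : StrictMono h)
      (i : Fin (n + 1)) : e i ≤ h i ∧ h i < m + 1 + e i := by
    have hm : Monotone fun i => ((h i : ℕ) : ℤ) - e i := by
      rw [Fin.monotone_iff_le_succ]
      intro i
      have h1 : (h i.castSucc : ℕ) < h i.succ := hh i.castSucc_lt_succ
      have h2 := hstep i
      omega
    have h1 := hm (Fin.zero_le i)
    have h2 := hm (Fin.le_last i)
    have h3 := (h (Fin.last n)).isLt
    dsimp only at h1 h2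
    omega
  rw [← card_strictMono_fin]
  exact Nat.card_congr
    { toFun g := ⟨fun i => ⟨g.1 i + e i, by have := hmono (Fin.le_last i); omega⟩, g.2⟩
      invFun h := ⟨fun i => ⟨h.1 i - e i, by have := key h.1 h.2 i; omega⟩, by
        have (i : Fin (n + 1)) : (h.1 i : ℕ) - e i + e i = h.1 i :=
          Nat.sub_add_cancel (key h.1 h.2 i).1
        simp only [this]
        exact h.2⟩
      left_inv g := by ext; simp
      right_inv h := by
        ext i
        exact Nat.sub_add_cancel (key h.1 h.2 i).1 }

theorem eq_sort_iff_succ {n : ℕ} {α : Type*} [LinearOrder α] (f : Fin (n + 1) → α)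
    (σ : Equiv.Perm (Fin (n + 1))) :
    σ = Tuple.sort f ↔ ∀ i : Fin n, f (σ i.castSucc) < f (σ i.succ) ∨
      f (σ i.castSucc) = f (σ i.succ) ∧ σ i.castSucc < σ i.succ := by
  rw [Tuple.eq_sort_iff', Fin.strictMono_iff_lt_succ]
  refine forall_congr' fun i => ?_
  exact Prod.Lex.toLex_lt_toLex

/-- The number of descents of a permutation. -/
def descentCount {n : ℕ} (σ : Equiv.Perm (Fin (n + 1))) : ℕ :=
  (Finset.univ.filter fun p : Fin n => σ p.succ < σ p.castSucc).card

theorem descentCount_le {n : ℕ} (σ : Equiv.Perm (Fin (n + 1))) : descentCount σ ≤ n :=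
  (Finset.card_le_univ _).trans_eq (Fintype.card_fin n)

theorem card_descents_eq_descentCount {n : ℕ} (σ : Equiv.Perm (Fin (n + 1))) :
    Nat.card {p : Fin (n + 1) // ∃ h : (p : ℕ) + 1 < n + 1, σ ⟨(p : ℕ) + 1, h⟩ < σ p} =
      descentCount σ := by
  rw [descentCount, ← Fintype.card_subtype, ← Nat.card_eq_fintype_card]
  exact Nat.card_congr
    { toFun p := ⟨⟨p.1, by have := p.2.1; omega⟩, p.2.2⟩
      invFun p := ⟨p.1.castSucc, Nat.succ_lt_succ p.1.isLt, p.2⟩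
      left_inv _ := rfl
      right_inv _ := rfl }

theorem eulerian_succ_eq_card (n i : ℕ) :
    eulerian (n + 1) i = (Finset.univ.filter fun σ : Equiv.Perm (Fin (n + 1)) =>
      descentCount σ = i).card := by
  simp only [eulerian, card_descents_eq_descentCount]
  rw [Nat.card_eq_fintype_card, Fintype.card_subtype]

theorem card_sort_eq {n : ℕ} (m : ℕ) (σ : Equiv.Perm (Fin (n + 1))) :
    Nat.card {f : Fin (n + 1) → Fin (m + 1) // Tuple.sort f = σ} =
      (m + (n + 1 - descentCount σ)).choose (n + 1) := by
  let e (i : Fin (n + 1)) : ℕ :=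
    (Finset.univ.filter fun p : Fin n => p.castSucc < i ∧ ¬ σ p.succ < σ p.castSucc).card
  have he (i : Fin n) :
      e i.succ = e i.castSucc + if σ i.succ < σ i.castSucc then 0 else 1 := by
    split_ifs with h
    · refine congrArg Finset.card (Finset.filter_congr fun p _ => ?_)
      rcases eq_or_ne p i with rfl | hp
      · simp [h]
      · have : (p : ℕ) ≠ i := Fin.val_ne_of_ne hp
        simp only [Fin.lt_def, Fin.val_succ, Fin.val_castSucc]
        omega
    · have hi : i ∉ Finset.univ.filter fun p : Fin n =>
          p.castSucc < i.castSucc ∧ ¬ σ p.succ < σ p.castSucc := by simp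
      rw [← Finset.card_insert_of_notMem hi]
      refine congrArg Finset.card (Finset.ext fun p => ?_)
      rcases eq_or_ne p i with rfl | hp
      · simpa using h
      · have : (p : ℕ) ≠ i := Fin.val_ne_of_ne hp
        simp only [Finset.mem_filter, Finset.mem_univ, true_and, Finset.mem_insert, hp, false_or,
          Fin.lt_def, Fin.val_succ, Fin.val_castSucc]
        omega
  have hlast : descentCount σ + e (Fin.last n) = n := by
    simpa [e, descentCount, Fin.castSucc_lt_last] using
      Finset.card_filter_add_card_filter_not (s := (Finset.univ : Finset (Fin n)))
        (fun p => σ p.succ < σ p.castSucc)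
  have hN : m + (n + 1 - descentCount σ) = m + 1 + e (Fin.last n) := by omega
  rw [hN, ← card_strictMono_add m e (by simp [e])
    (Fin.monotone_iff_le_succ.2 fun i => by rw [he]; exact Nat.le_add_right _ _)
    (fun i => by rw [he]; split_ifs <;> omega)]
  refine Nat.card_congr ((σ.symm.arrowCongr (Equiv.refl _)).subtypeEquiv fun f => ?_)
  rw [eq_comm, eq_sort_iff_succ, Fin.strictMono_iff_lt_succ]
  refine forall_congr' fun i => ?_
  have hne : σ i.succ ≠ σ i.castSucc := σ.injective.ne (Fin.castSucc_lt_succ).ne'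
  simp only [he, Equiv.arrowCongr_apply, Function.comp_apply, Equiv.symm_symm, Equiv.refl_apply]
  rw [Fin.lt_def, Fin.ext_iff]
  split_ifs with h
  · have := h.not_gt
    simp only [this, and_false, or_false]
    omega
  · have : σ i.castSucc < σ i.succ := lt_of_le_of_ne (not_lt.1 h) hne.symm
    simp only [this, and_true]
    omega

theorem eulerian_zero_left (i : ℕ) : eulerian 0 i = if i = 0 then 1 else 0 := by
  simp only [eulerian, Nat.card_of_isEmpty]
  split_ifs with h
  · simp [h]
  · simp [Ne.symm h]

theorem eulerian_eq_zero_of_lt {k i : ℕ} (h : k < i) : eulerian k i = 0 := by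
  cases k with
  | zero => rw [eulerian_zero_left, if_neg h.ne']
  | succ n =>
    rw [eulerian_succ_eq_card, Finset.card_eq_zero, Finset.filter_eq_empty_iff]
    intro σ _
    have := descentCount_le σ
    omega

/-- Worpitzky's identity. -/
theorem worpitzky (m k : ℕ) :
    (m + 1) ^ k = ∑ i ∈ Finset.range (k + 1), eulerian k i * (m + (k - i)).choose k := by
  cases k with
  | zero => simp [eulerian_zero_left]
  | succ n =>
    calc (m + 1) ^ (n + 1)
        = Fintype.card (Fin (n + 1) → Fin (m + 1)) := by simp
      _ = ∑ σ : Equiv.Perm (Fin (n + 1)),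
            (m + (n + 1 - descentCount σ)).choose (n + 1) := by
          rw [← Finset.card_univ, Finset.card_eq_sum_card_fiberwise (f := Tuple.sort)
            (t := Finset.univ) (by simp)]
          refine Finset.sum_congr rfl fun σ _ => ?_
          rw [← card_sort_eq, Nat.card_eq_fintype_card, Fintype.card_subtype]
      _ = _ := by
          rw [← Finset.sum_fiberwise_of_maps_to (g := descentCount)
            (t := Finset.range (n + 1 + 1)) fun σ _ => by
              have := descentCount_le σ
              rw [Finset.mem_range]; omega]
          refine Finset.sum_congr rfl fun i _ => ?_
          rw [eulerian_succ_eq_card, Finset.sum_congr rfl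
            (g := fun _ => (m + (n + 1 - i)).choose (n + 1)) fun σ hσ => by
              rw [(Finset.mem_filter.1 hσ).2],
            Finset.sum_const, smul_eq_mul]

theorem sum_choose_mul_choose_sub {m n k i : ℕ} (hmn : m ≤ n) (hik : i ≤ k) :
    (∑ j ∈ Finset.range (n + 1), if i ≤ j then m.choose j * (k - i).choose (j - i) else 0) =
      (m + (k - i)).choose k := by
  rw [Nat.add_choose_eq, Finset.Nat.sum_antidiagonal_eq_sum_range_succ_mk]
  have h1 : ∀ j, (j ∉ Finset.range (k + 1) ∨ j ∉ Finset.range (n + 1)) →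
      (if i ≤ j then m.choose j * (k - i).choose (j - i) else 0) = 0 := by
    intro j hj
    simp only [Finset.mem_range] at hj
    split_ifs with hij
    · rcases hj with hj | hj
      · rw [Nat.choose_eq_zero_of_lt (by omega : k - i < j - i), mul_zero]
      · rw [Nat.choose_eq_zero_of_lt (by omega : m < j), zero_mul]
    · rfl
  calc _ = ∑ j ∈ Finset.range (k + 1),
        if i ≤ j then m.choose j * (k - i).choose (j - i) else 0 := by
        rcases le_total n k with h | h
        · exact Finset.sum_subset (Finset.range_mono (by omega)) fun j _ hj => h1 j (.inr hj)
        · exact (Finset.sum_subset (Finset.range_mono (by omega))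
            fun j _ hj => h1 j (.inl hj)).symm
    _ = _ := by
        refine Finset.sum_congr rfl fun j hj => ?_
        rw [Finset.mem_range] at hj
        dsimp only
        split_ifs with hij
        · rw [← Nat.choose_symm (by omega : j - i ≤ k - i)]
          congr 2
          omega
        · rw [Nat.choose_eq_zero_of_lt (by omega : k - i < k - j), mul_zero]

theorem succ_pow_eq_sum_choose_mul_eulerian {m n : ℕ} (k : ℕ) (hmn : m ≤ n) :
    (m + 1) ^ k = ∑ j ∈ Finset.range (n + 1), ∑ i ∈ Finset.range (j + 1),
      (k - i).choose (j - i) * eulerian k i * m.choose j := by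
  have h (j : ℕ) : ∑ i ∈ Finset.range (j + 1),
      (k - i).choose (j - i) * eulerian k i * m.choose j =
      ∑ i ∈ Finset.range (k + 1),
        eulerian k i * if i ≤ j then m.choose j * (k - i).choose (j - i) else 0 := by
    have h1 : ∀ i, (i ∉ Finset.range (k + 1) ∨ i ∉ Finset.range (j + 1)) →
        (eulerian k i * if i ≤ j then m.choose j * (k - i).choose (j - i) else 0) = 0 := by
      intro i hi
      simp only [Finset.mem_range] at hi
      rcases hi with hi | hi
      · rw [eulerian_eq_zero_of_lt (by omega), zero_mul]
      · rw [if_neg (by omega), mul_zero]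
    trans ∑ i ∈ Finset.range (j + 1),
        eulerian k i * if i ≤ j then m.choose j * (k - i).choose (j - i) else 0
    · refine Finset.sum_congr rfl fun i hi => ?_
      rw [if_pos (Nat.lt_succ_iff.1 (Finset.mem_range.1 hi))]
      ring
    · rcases le_total j k with h | h
      · exact Finset.sum_subset (Finset.range_mono (by omega)) fun i _ hi => h1 i (.inr hi)
      · exact (Finset.sum_subset (Finset.range_mono (by omega))
          fun i _ hi => h1 i (.inl hi)).symm
  simp only [h]
  rw [Finset.sum_comm, worpitzky]
  refine Finset.sum_congr rfl fun i hi => ?_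
  rw [← Finset.mul_sum, sum_choose_mul_choose_sub hmn (Nat.lt_succ_iff.1 (Finset.mem_range.1 hi))]

theorem polyCauchy_eq_sum_eulerian (n k : ℕ) :
    polyCauchy n k = ∑ m ∈ Finset.range (n + 1), ∑ i ∈ Finset.range (m + 1),
      Nat.choose (k - i) (m - i) * eulerian k i * stirling1 (n + 1) (m + 1) := by
  simp only [polyCauchy, stirling1_succ_succ_eq_sum_choose, ← Finset.sum_mul]
  simp only [Finset.mul_sum]
  rw [Finset.sum_comm]
  refine Finset.sum_congr rfl fun m hm => ?_
  rw [succ_pow_eq_sum_choose_mul_eulerian k (Nat.lt_succ_iff.1 (Finset.mem_range.1 hm)),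
    Finset.mul_sum]
  refine Finset.sum_congr rfl fun j _ => ?_
  rw [← Finset.sum_mul]
  ring
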